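/- arXiv:2202.06677 — 2 statements merged into one kernel-verified Lean document; each statement's English description precedes it below -/
import Mathlib

section
/- Let Σ and Σ̂ be metric systems with the same output set Y and metric d, and let ε, δ ≥ 0 with ε ≤ δ/2. If there exists an ε-approximate initial-state opacity preserving simulation relation from Σ to Σ̂ (i.e., Σ ⪯_I^ε Σ̂), and Σ̂ is (δ − 2ε)-approximate initial-state opaque, then Σ is δ-approximate initial-state opaque. -/
/-!
Statement 3: if Σ ⪯_I^ε Σ̂ with ε ≤ δ/2 and Σ̂ is (δ − 2ε)-approximate
initial-state opaque, then Σ is δ-approximate initial-state opaque.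
-/

variable {X X' U U' Y : Type*}

/-- A finite path of length `n` of the system with initial states `X0` and
transition relation `tr`. -/
def IsPath {S I : Type*} (X0 : Set S) (tr : S → I → S → Prop) (n : ℕ)
    (p : ℕ → S) : Prop :=
  p 0 ∈ X0 ∧ ∀ i < n, ∃ u, tr (p i) u (p (i + 1))

/-- δ-approximate initial-state opacity. -/
def ApproxInitStateOpaque {S I : Type*} [MetricSpace Y] (X0 XS : Set S)
    (tr : S → I → S → Prop) (H : S → Y) (δ : ℝ) : Prop :=
  ∀ n : ℕ, ∀ p : ℕ → S, IsPath X0 tr n p → p 0 ∈ XS →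
    ∃ p' : ℕ → S, IsPath X0 tr n p' ∧ p' 0 ∉ XS ∧
      ∀ i ≤ n, dist (H (p i)) (H (p' i)) ≤ δ

/-- `R` is an ε-approximate initial-state opacity preserving (ε-InitSOP)
simulation relation from the system `(X0, XS, tr, H)` to `(X0', XS', tr', H')`,
both with outputs in the same metric space `Y`. -/
def InitSOP [MetricSpace Y] (X0 XS : Set X) (tr : X → U → X → Prop) (H : X → Y)
    (X0' XS' : Set X') (tr' : X' → U' → X' → Prop) (H' : X' → Y)
    (ε : ℝ) (R : Set (X × X')) : Prop :=
  (∀ x0 ∈ X0 ∩ XS, ∃ x0' ∈ X0' ∩ XS', (x0, x0') ∈ R) ∧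
  (∀ x0' ∈ X0' \ XS', ∃ x0 ∈ X0 \ XS, (x0, x0') ∈ R) ∧
  (∀ p ∈ R, dist (H p.1) (H' p.2) ≤ ε) ∧
  (∀ p ∈ R,
    (∀ u x₁, tr p.1 u x₁ → ∃ u' x₂, tr' p.2 u' x₂ ∧ (x₁, x₂) ∈ R) ∧
    (∀ u' x₂, tr' p.2 u' x₂ → ∃ u x₁, tr p.1 u x₁ ∧ (x₁, x₂) ∈ R))

/-- A finite path can be matched step by step along a simulation relation, starting from any
state related to its initial state. -/
theorem exists_related_steps {A B I J : Type*} {trA : A → I → A → Prop} {trB : B → J → B → Prop}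
    {r : A → B → Prop}
    (hr : ∀ a b, r a b → ∀ u a₁, trA a u a₁ → ∃ v b₁, trB b v b₁ ∧ r a₁ b₁)
    (p : ℕ → A) {b : B} (hb : r (p 0) b) (n : ℕ)
    (hp : ∀ i < n, ∃ u, trA (p i) u (p (i + 1))) :
    ∃ q : ℕ → B, q 0 = b ∧ (∀ i < n, ∃ v, trB (q i) v (q (i + 1))) ∧ ∀ i ≤ n, r (p i) (q i) := by
  induction n with
  | zero => exact ⟨fun _ => b, rfl, by simp, by simpa using hb⟩
  | succ n ih =>
    obtain ⟨q, hq0, hq, hpq⟩ := ih fun i hi => hp i (by omega)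
    obtain ⟨u, hu⟩ := hp n (by omega)
    obtain ⟨v, c, hv, hc⟩ := hr _ _ (hpq n le_rfl) u _ hu
    refine ⟨Function.update q (n + 1) c, by simpa using hq0, fun i hi => ?_, fun i hi => ?_⟩
    · rw [Function.update_of_ne (by omega)]
      rcases Nat.lt_succ_iff_lt_or_eq.mp hi with h | rfl
      · rw [Function.update_of_ne (by omega)]
        exact hq i h
      · exact ⟨v, by simpa using hv⟩
    · rcases Nat.le_succ_iff.mp hi with h | rfl
      · rw [Function.update_of_ne (by omega)]
        exact hpq i h
      · simpa using hc

/-- **Abstraction-based opacity verification.** If `Σ ⪯_I^ε Σ̂` with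
`ε ≤ δ/2` and `Σ̂` is `(δ − 2ε)`-approximate initial-state opaque, then `Σ` is
`δ`-approximate initial-state opaque. -/
theorem abstraction_based_opacity_verification [MetricSpace Y]
    (X0 XS : Set X) (tr : X → U → X → Prop) (H : X → Y)
    (X0' XS' : Set X') (tr' : X' → U' → X' → Prop) (H' : X' → Y)
    (ε δ : ℝ) (hε : 0 ≤ ε) (hδ : 0 ≤ δ) (hεδ : ε ≤ δ / 2)
    (hsim : ∃ R : Set (X × X'), InitSOP X0 XS tr H X0' XS' tr' H' ε R)
    (hop : ApproxInitStateOpaque X0' XS' tr' H' (δ - 2 * ε)) :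
    ApproxInitStateOpaque X0 XS tr H δ := by
  obtain ⟨R, hinit, hinit', hdist, hstep⟩ := hsim
  intro n p hp hpS
  obtain ⟨b, ⟨hb0, hbS⟩, hpb⟩ := hinit (p 0) ⟨hp.1, hpS⟩
  obtain ⟨q, rfl, hq, hpq⟩ := exists_related_steps (r := fun x x' => (x, x') ∈ R)
    (fun x x' h => (hstep (x, x') h).1) p hpb n hp.2
  obtain ⟨q', hq', hqS', hqq'⟩ := hop n q ⟨hb0, hq⟩ hbS
  obtain ⟨a, ⟨ha0, haS⟩, haq⟩ := hinit' (q' 0) ⟨hq'.1, hqS'⟩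
  obtain ⟨p', rfl, hp', hpq'⟩ := exists_related_steps (r := fun x' x => (x, x') ∈ R)
    (fun x' x h => (hstep (x, x') h).2) q' haq n hq'.2
  refine ⟨p', ⟨ha0, hp'⟩, haS, fun i hi => ?_⟩
  have h₁ : dist (H (p i)) (H' (q i)) ≤ ε := hdist _ (hpq i hi)
  have h₂ : dist (H (p' i)) (H' (q' i)) ≤ ε := hdist _ (hpq' i hi)
  rw [dist_comm] at h₂
  have h₃ := dist_triangle4 (H (p i)) (H' (q i)) (H' (q' i)) (H (p' i))
  linarith [hqq' i hi]
end

section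
/- Let R be an ε-approximate initial-state opacity preserving simulation relation from a metric system Σ to a metric system Σ̂ (with the same output set Y and metric d). Then for every finite path x̂₀x̂₁⋯x̂ₙ of Σ̂ with x̂₀ ∈ X̂₀ ∖ X̂_S, there exists a finite path x₀x₁⋯xₙ of Σ with x₀ ∈ X₀ ∖ X_S such that (xᵢ, x̂ᵢ) ∈ R and d(H(xᵢ), Ĥ(x̂ᵢ)) ≤ ε for all 0 ≤ i ≤ n. -/
/-!
Statement 5: along an ε-InitSOP simulation relation, every non-secret-initialized
finite path of Σ̂ is matched, state by state, by a non-secret-initialized finite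
path of Σ with ε-close outputs.
-/

variable {X X' U U' Y : Type*}

/-- A finite chain of `r'` lifts to a chain of `r` starting at any state related to its
first state, provided that single steps lift. -/
theorem exists_chain_lift {S S' : Type*} {r : S → S → Prop} {r' : S' → S' → Prop}
    {R : S → S' → Prop} (h : ∀ a a' b', R a a' → r' a' b' → ∃ b, r a b ∧ R b b') (n : ℕ) :
    ∀ (a : S) (p' : ℕ → S'), R a (p' 0) → (∀ i < n, r' (p' i) (p' (i + 1))) →
      ∃ p : ℕ → S, p 0 = a ∧ (∀ i < n, r (p i) (p (i + 1))) ∧ ∀ i ≤ n, R (p i) (p' i) := by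
  induction n with
  | zero =>
    intro a p' ha _
    exact ⟨fun _ => a, rfl, by simp, by simpa using ha⟩
  | succ n ih =>
    intro a p' ha hp'
    obtain ⟨b, hab, hb⟩ := h a _ _ ha (hp' 0 n.succ_pos)
    obtain ⟨q, rfl, hq, hqR⟩ :=
      ih b (fun i => p' (i + 1)) hb fun i hi => hp' (i + 1) (Nat.succ_lt_succ hi)
    refine ⟨fun i => Nat.casesOn i a q, rfl, ?_, ?_⟩
    · rintro (_ | i) hi
      · exact hab
      · exact hq i (Nat.lt_of_succ_lt_succ hi)
    · rintro (_ | i) hi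
      · exact ha
      · exact hqR i (Nat.le_of_succ_le_succ hi)

/-- **Backward path lifting along an ε-InitSOP simulation relation.** For every
finite path of Σ̂ starting in `X0' \ XS'`, there is a finite path of Σ starting
in `X0 \ XS` that stays in relation `R` and has ε-close outputs throughout. -/
theorem initSOP_nonsecret_path_lifting [MetricSpace Y]
    (X0 XS : Set X) (tr : X → U → X → Prop) (H : X → Y)
    (X0' XS' : Set X') (tr' : X' → U' → X' → Prop) (H' : X' → Y)
    (ε : ℝ) (R : Set (X × X'))
    (hR : InitSOP X0 XS tr H X0' XS' tr' H' ε R)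
    (n : ℕ) (p' : ℕ → X') (hp' : IsPath X0' tr' n p') (h0 : p' 0 ∈ X0' \ XS') :
    ∃ p : ℕ → X, IsPath X0 tr n p ∧ p 0 ∈ X0 \ XS ∧
      ∀ i ≤ n, (p i, p' i) ∈ R ∧ dist (H (p i)) (H' (p' i)) ≤ ε := by
  obtain ⟨-, h_init, h_dist, h_step⟩ := hR
  obtain ⟨x, hx, hxR⟩ := h_init _ h0
  obtain ⟨p, rfl, hp, hpR⟩ := exists_chain_lift (r := fun a b => ∃ u, tr a u b)
    (r' := fun a b => ∃ u, tr' a u b) (R := fun a a' => (a, a') ∈ R)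
    (fun a a' b' ha ⟨u', hu'⟩ =>
      let ⟨u, b, hab, hb⟩ := (h_step (a, a') ha).2 u' b' hu'
      ⟨b, ⟨u, hab⟩, hb⟩)
    n x p' hxR hp'.2
  exact ⟨p, ⟨hx.1, hp⟩, hx, fun i hi => ⟨hpR i hi, h_dist _ (hpR i hi)⟩⟩
end
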